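/- arXiv:math/0409275 — 2 statements merged into one kernel-verified Lean document; each statement's English description precedes it below -/
import Mathlib

section
/- Every nilpotent Lie algebra law on ℂ³ lies in the closure of the GL_3(ℂ)-orbit of the Heisenberg law 𝔫₃; that is, 𝒩₃(ℂ) = closure(O(𝔫₃(ℂ))), where 𝔫₃ is defined on a basis (e₁,e₂,e₃) by [e₁,e₂] = e₃ (all other basis brackets zero). -/
open Module Submodule Filter Topology

/-- The underlying vector space `ℂⁿ`. -/
abbrev V (n : ℕ) : Type := Fin n → ℂ

/-- A Lie algebra law on `ℂⁿ`: an alternating bilinear map satisfying the Jacobi identity. -/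
def IsLieLaw {n : ℕ} (μ : V n → V n → V n) : Prop :=
  (∀ (a : ℂ) (x y z : V n), μ (a • x + y) z = a • μ x z + μ y z) ∧
  (∀ (a : ℂ) (x y z : V n), μ x (a • y + z) = a • μ x y + μ x z) ∧
  (∀ x : V n, μ x x = 0) ∧
  (∀ x y z : V n, μ x (μ y z) + μ y (μ z x) + μ z (μ x y) = 0)

/-- The base-change action of `GL_n(ℂ)` on laws: `(g·μ)(x,y) = g (μ (g⁻¹ x) (g⁻¹ y))`. -/
noncomputable def act {n : ℕ} (g : V n ≃ₗ[ℂ] V n) (μ : V n → V n → V n) : V n → V n → V n :=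
  fun x y => g (μ (g.symm x) (g.symm y))

/-- The `GL_n(ℂ)`-orbit of a law. -/
def lieOrbit {n : ℕ} (μ : V n → V n → V n) : Set (V n → V n → V n) :=
  {ν | ∃ g : V n ≃ₗ[ℂ] V n, ν = act g μ}

/-- `μ` is a degeneration of `λ` if `μ` lies in the closure of the orbit of `λ`. -/
def Degenerates {n : ℕ} (lam mu : V n → V n → V n) : Prop :=
  mu ∈ closure (lieOrbit lam)

/-- Lower central series: `C^0 = V`, `C^(k+1) = span{μ(x,y) : x ∈ V, y ∈ C^k}`. -/
noncomputable def lcs {n : ℕ} (μ : V n → V n → V n) : ℕ → Submodule ℂ (V n)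
  | 0 => ⊤
  | k + 1 => Submodule.span ℂ {z | ∃ x : V n, ∃ y ∈ lcs μ k, z = μ x y}

/-- A law is nilpotent if its lower central series terminates in `0`. -/
noncomputable def IsNilpotentLaw {n : ℕ} (μ : V n → V n → V n) : Prop :=
  ∃ k : ℕ, lcs μ k = ⊥

/-- The Heisenberg law `𝔫₃` on `ℂ³`: `[e₁,e₂] = e₃`. -/
noncomputable def n3Law : V 3 → V 3 → V 3 := fun x y =>
  ![0, 0, x 0 * y 1 - x 1 * y 0]

/-- The law `(x, y) ↦ det(v, x, y) v`. -/
noncomputable def detLaw (v : V 3) : V 3 → V 3 → V 3 := fun x y =>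
  (v 0 * (x 1 * y 2 - x 2 * y 1) + v 1 * (x 2 * y 0 - x 0 * y 2)
    + v 2 * (x 0 * y 1 - x 1 * y 0)) • v

/-- The base change sending `n3Law` to `detLaw v`. -/
noncomputable def detEquiv (v : V 3) (hv : v 2 ≠ 0) : V 3 ≃ₗ[ℂ] V 3 where
  toFun x := ![x 0 / v 2 + x 2 * v 0, x 1 + x 2 * v 1, x 2 * v 2]
  invFun y := ![v 2 * (y 0 - y 2 / v 2 * v 0), y 1 - y 2 / v 2 * v 1, y 2 / v 2]
  map_add' x y := by
    ext i; fin_cases i <;> simp <;> ring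
  map_smul' a x := by
    ext i; fin_cases i <;> simp <;> ring
  left_inv x := by
    ext i; fin_cases i <;> simp <;> field_simp <;> ring
  right_inv x := by
    ext i; fin_cases i <;> simp <;> field_simp <;> ring

theorem detLaw_mem_orbit (v : V 3) (hv : v 2 ≠ 0) : detLaw v ∈ lieOrbit n3Law := by
  refine ⟨detEquiv v hv, ?_⟩
  funext x y
  ext i
  fin_cases i <;> simp [act, detEquiv, detLaw, n3Law, -mul_eq_mul_right_iff] <;> field_simp <;> ring

theorem continuous_detLaw : Continuous detLaw := by
  unfold detLaw
  fun_prop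

theorem detLaw_mem_closure (v : V 3) : detLaw v ∈ closure (lieOrbit n3Law) := by
  have h1 : v ∈ closure {w : V 3 | w 2 ≠ 0} := by
    by_cases hv : v 2 = 0
    · have ht : Tendsto (fun n : ℕ => v + (1 / ((n : ℂ) + 1)) • (Pi.single 2 1 : V 3)) atTop
          (𝓝 (v + (0 : ℂ) • (Pi.single 2 1 : V 3))) :=
        tendsto_const_nhds.add
          ((tendsto_one_div_add_atTop_nhds_zero_nat (𝕜 := ℂ)).smul_const _)
      rw [zero_smul, add_zero] at ht
      refine mem_closure_of_tendsto ht (Eventually.of_forall fun n => ?_)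
      have : (n : ℂ) + 1 ≠ 0 := Nat.cast_add_one_ne_zero n
      simp [hv, this]
    · exact subset_closure hv
  have h2 := image_closure_subset_closure_image continuous_detLaw ⟨v, h1, rfl⟩
  refine closure_mono ?_ h2
  rintro _ ⟨w, hw, rfl⟩
  exact detLaw_mem_orbit w hw

theorem eq_sum_single (x : V 3) :
    x = x 0 • (Pi.single 0 1 : V 3) + (x 1 • (Pi.single 1 1 : V 3)
      + (x 2 • (Pi.single 2 1 : V 3) + 0)) := by
  ext i; fin_cases i <;> simp

/-- The linear map `ad x`. -/
def adMap (μ : V 3 → V 3 → V 3) (hr : ∀ (a : ℂ) (x y z : V 3), μ x (a • y + z) = a • μ x y + μ x z)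
    (x : V 3) : V 3 →ₗ[ℂ] V 3 :=
  have h0 : μ x 0 = 0 := by simpa using hr 1 x 0 0
  { toFun := μ x
    map_add' := fun y z => by simpa using hr 1 x y z
    map_smul' := fun a y => by simpa [h0] using hr a x y 0 }

theorem adMap_pow_mem (μ : V 3 → V 3 → V 3) (hr : ∀ (a : ℂ) (x y z : V 3), μ x (a • y + z) = a • μ x y + μ x z) (x y : V 3) (k : ℕ) :
    ((adMap μ hr x) ^ k) y ∈ lcs μ k := by
  induction k with
  | zero => simp [lcs]
  | succ k ih =>
    rw [pow_succ', lcs]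
    exact Submodule.subset_span ⟨x, _, ih, rfl⟩

theorem trace_adMap (μ : V 3 → V 3 → V 3) (hr : ∀ (a : ℂ) (x y z : V 3), μ x (a • y + z) = a • μ x y + μ x z) (hn : IsNilpotentLaw μ) (x : V 3) :
    (μ x (Pi.single 0 1) 0 + μ x (Pi.single 1 1) 1 + μ x (Pi.single 2 1) 2 = 0) ∧
    (∑ i, ∑ j, μ x (Pi.single i 1) j * μ x (Pi.single j 1) i = 0) := by
  obtain ⟨k, hk⟩ := hn
  have hnil : IsNilpotent (adMap μ hr x) := ⟨k, by
    ext1 y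
    have := adMap_pow_mem μ hr x (Pi.single y 1) k
    rw [hk, Submodule.mem_bot] at this
    ext1
    simp [this]⟩
  have hm : IsNilpotent (LinearMap.toMatrix' (adMap μ hr x)) :=
    hnil.map (LinearMap.toMatrixAlgEquiv' (R := ℂ) (n := Fin 3))
  have hm2 : IsNilpotent (LinearMap.toMatrix' (adMap μ hr x) * LinearMap.toMatrix' (adMap μ hr x)) := by
    exact (Commute.refl _).isNilpotent_mul_right hm
  have t1 := (Matrix.isNilpotent_trace_of_isNilpotent hm).eq_zero
  have t2 := (Matrix.isNilpotent_trace_of_isNilpotent hm2).eq_zero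
  constructor
  · simpa [Matrix.trace_fin_three, LinearMap.toMatrix'_apply, adMap] using t1
  · rw [← t2, Matrix.trace]
    simp [Matrix.mul_apply, LinearMap.toMatrix'_apply, adMap, Fin.sum_univ_three]
    ring

theorem exists_sqrt_vec (a0 a1 a2 b1 b2 c2 : ℂ) (h1 : a0 * b1 = a1 ^ 2) (h2 : a0 * c2 = a2 ^ 2)
    (h3 : b1 * c2 = b2 ^ 2) (h4 : a0 * b2 = a1 * a2) :
    ∃ p q r : ℂ, p * p = a0 ∧ p * q = a1 ∧ p * r = a2 ∧ q * q = b1 ∧ q * r = b2 ∧ r * r = c2 := by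
  by_cases ha : a0 = 0
  · subst ha
    have e1 : a1 = 0 := by simpa using h1.symm
    have e2 : a2 = 0 := by simpa using h2.symm
    by_cases hb : b1 = 0
    · subst hb
      have e3 : b2 = 0 := by simpa using h3.symm
      obtain ⟨s, hs⟩ := IsAlgClosed.exists_eq_mul_self c2
      exact ⟨0, 0, s, by simp, by simp [e1], by simp [e2], by simp, by simp [e3], hs.symm⟩
    · obtain ⟨s, hs⟩ := IsAlgClosed.exists_eq_mul_self b1
      have hs0 : s ≠ 0 := by rintro rfl; simp at hs; exact hb hs
      refine ⟨0, s, b2 / s, by simp, by simp [e1], by simp [e2], hs.symm, by field_simp, ?_⟩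
      field_simp
      rw [← h3, hs]; ring
  · obtain ⟨s, hs⟩ := IsAlgClosed.exists_eq_mul_self a0
    have hs0 : s ≠ 0 := by rintro rfl; simp at hs; exact ha hs
    refine ⟨s, a1 / s, a2 / s, hs.symm, by field_simp, by field_simp, ?_, ?_, ?_⟩
    · field_simp; rw [← h1, hs]; ring
    · field_simp; rw [← h4, hs]; ring
    · field_simp; rw [← h2, hs]; ring

theorem bilin_expand (μ : V 3 → V 3 → V 3)
    (hl : ∀ (a : ℂ) (x y z : V 3), μ (a • x + y) z = a • μ x z + μ y z)
    (hr : ∀ (a : ℂ) (x y z : V 3), μ x (a • y + z) = a • μ x y + μ x z) (x y : V 3) :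
    μ x y = ∑ i, ∑ j, (x i * y j) • μ (Pi.single i 1) (Pi.single j 1) := by
  have h0 : ∀ x, μ x 0 = 0 := fun x => by simpa using hr 1 x 0 0
  have h0' : ∀ x, μ 0 x = 0 := fun x => by simpa using hl 1 0 0 x
  conv_lhs => rw [eq_sum_single x, eq_sum_single y]
  simp only [hl, hr, h0, h0']
  simp only [Fin.sum_univ_three, add_zero, smul_zero, smul_add, smul_smul]
  abel

theorem exists_detLaw (μ : V 3 → V 3 → V 3) (h : IsLieLaw μ) (hn : IsNilpotentLaw μ) :
    ∃ v, μ = detLaw v := by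
  obtain ⟨hl, hr, halt, -⟩ := h
  have hadd : ∀ x y z, μ (x + y) z = μ x z + μ y z := fun x y z => by simpa using hl 1 x y z
  have hadd' : ∀ x y z, μ z (x + y) = μ z x + μ z y := fun x y z => by simpa using hr 1 z x y
  have hskew : ∀ x y, μ x y = - μ y x := fun x y => by
    have := halt (x + y)
    rw [hadd, hadd', hadd', halt, halt, zero_add, add_zero] at this
    exact eq_neg_of_add_eq_zero_left this
  have s1 := hskew (Pi.single 1 1) (Pi.single 0 1)
  have s2 := hskew (Pi.single 2 1) (Pi.single 1 1)
  have s3 := hskew (Pi.single 0 1) (Pi.single 2 1)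
  have T := trace_adMap μ hr hn
  obtain ⟨t0, q0⟩ := T (Pi.single 0 1)
  obtain ⟨t1, q1⟩ := T (Pi.single 1 1)
  obtain ⟨t2, q2⟩ := T (Pi.single 2 1)
  have q01 := (T (Pi.single 0 1 + Pi.single 1 1)).2
  have q02 := (T (Pi.single 0 1 + Pi.single 2 1)).2
  have q12 := (T (Pi.single 1 1 + Pi.single 2 1)).2
  have E := bilin_expand μ hl hr
  simp only [Fin.sum_univ_three, hadd, s1, s2, s3, halt, Pi.add_apply, Pi.neg_apply,
    Pi.zero_apply] at t0 q0 t1 q1 t2 q2 q01 q02 q12 E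
  generalize μ (Pi.single 1 1) (Pi.single 2 1) = a at *
  generalize μ (Pi.single 2 1) (Pi.single 0 1) = b at *
  generalize μ (Pi.single 0 1) (Pi.single 1 1) = c at *
  have u0 : c 1 = b 2 := by linear_combination t0
  have u1 : a 2 = c 0 := by linear_combination t1
  have u2 : b 0 = a 1 := by linear_combination t2
  rw [u0, ← u1, u2] at *
  obtain ⟨p, q, r, e1, e2, e3, e4, e5, e6⟩ :=
    exists_sqrt_vec (a 0) (a 1) (a 2) (b 1) (b 2) (c 2) (by grind) (by grind) (by grind) (by grind)
  refine ⟨![p, q, r], ?_⟩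
  funext x y
  rw [E]
  ext i
  fin_cases i <;> simp [detLaw] <;> grind

/-- Bilinear alternating laws with `μ x (μ y z) = 0` (written out in coordinates). -/
def twoStep : Set (V 3 → V 3 → V 3) :=
  {μ | (∀ (a : ℂ) (x y z : V 3), μ (a • x + y) z = a • μ x z + μ y z) ∧
    (∀ (a : ℂ) (x y z : V 3), μ x (a • y + z) = a • μ x y + μ x z) ∧
    (∀ x : V 3, μ x x = 0) ∧
    (∀ x y z : V 3, μ y z 0 • μ x (Pi.single 0 1) + (μ y z 1 • μ x (Pi.single 1 1)
      + μ y z 2 • μ x (Pi.single 2 1)) = 0)}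

theorem isClosed_twoStep : IsClosed twoStep := by
  unfold twoStep
  simp only [Set.ofPred_and, Set.ofPred_forall]
  refine IsClosed.inter ?_ (IsClosed.inter ?_ (IsClosed.inter ?_ ?_)) <;>
  · repeat refine isClosed_iInter fun _ => ?_
    exact isClosed_eq (by fun_prop) (by fun_prop)

theorem twoStep_comp {μ : V 3 → V 3 → V 3}
    (hr : ∀ (a : ℂ) (x y z : V 3), μ x (a • y + z) = a • μ x y + μ x z) (x w : V 3) :
    μ x w = w 0 • μ x (Pi.single 0 1) + (w 1 • μ x (Pi.single 1 1)
      + w 2 • μ x (Pi.single 2 1)) := by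
  have h0 : μ x 0 = 0 := by simpa using hr 1 x 0 0
  conv_lhs => rw [eq_sum_single w, hr, hr, hr, h0, add_zero]

theorem orbit_subset_twoStep : lieOrbit n3Law ⊆ twoStep := by
  rintro _ ⟨g, rfl⟩
  have hl : ∀ (a : ℂ) (x y z : V 3), n3Law (a • x + y) z = a • n3Law x z + n3Law y z := by
    intro a x y z; ext i; fin_cases i <;> simp [n3Law]; ring
  have hr : ∀ (a : ℂ) (x y z : V 3), n3Law x (a • y + z) = a • n3Law x y + n3Law x z := by
    intro a x y z; ext i; fin_cases i <;> simp [n3Law]; ring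
  have hr' : ∀ (a : ℂ) (x y z : V 3),
      act g n3Law x (a • y + z) = a • act g n3Law x y + act g n3Law x z := by
    intro a x y z; simp [act, hr]
  refine ⟨?_, hr', ?_, ?_⟩
  · intro a x y z; simp [act, hl]
  · intro x
    have : n3Law (g.symm x) (g.symm x) = 0 := by
      ext i; fin_cases i <;> simp [n3Law]; ring
    simp [act, this]
  · intro x y z
    rw [← twoStep_comp hr']
    have : ∀ u v w, n3Law u (n3Law v w) = 0 := by
      intro u v w; ext i; fin_cases i <;> simp [n3Law]
    simp [act, this]

theorem twoStep_nilp {μ : V 3 → V 3 → V 3} (h : μ ∈ twoStep) :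
    IsLieLaw μ ∧ IsNilpotentLaw μ := by
  obtain ⟨hl, hr, ha, hc⟩ := h
  have h2 : ∀ x y z, μ x (μ y z) = 0 := fun x y z => by rw [twoStep_comp hr, hc]
  refine ⟨⟨hl, hr, ha, fun x y z => by simp [h2]⟩, 2, ?_⟩
  have h0 : ∀ x, μ x 0 = 0 := fun x => by simpa using hr 1 x 0 0
  simp only [lcs]
  rw [Submodule.span_eq_bot]
  rintro _ ⟨x, y, hy, rfl⟩
  induction hy using Submodule.span_induction with
  | mem w hw => obtain ⟨u, v, -, rfl⟩ := hw; exact h2 _ _ _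
  | zero => exact h0 x
  | add u v _ _ hu hv => simpa [hu, hv] using hr 1 x u v
  | smul a u _ hu => simpa [hu, h0] using hr a x u 0

theorem stmt8 :
    {μ : V 3 → V 3 → V 3 | IsLieLaw μ ∧ IsNilpotentLaw μ} = closure (lieOrbit n3Law) := by
  apply Set.Subset.antisymm
  · rintro μ ⟨h, hn⟩
    obtain ⟨v, rfl⟩ := exists_detLaw μ h hn
    exact detLaw_mem_closure v
  · intro μ hμ
    exact twoStep_nilp (closure_minimal orbit_subset_twoStep isClosed_twoStep hμ)
end

section
/- Every nilpotent Lie algebra law on ℂ⁶ lies in the closure of the GL_6(ℂ)-orbit of the filiform law 𝔤_{6,E}; that is, 𝒩₆(ℂ) = closure(O(𝔤_{6,E})), where 𝔤_{6,E} is defined on a basis (e₁,…,e₆) by [e₁,e_i] = e_{i+1} for 2 ≤ i ≤ 5, [e₂,e₃] = e₅, [e₂,e₄] = e₆, [e₂,e₅] = e₆, [e₃,e₄] = −e₆ (all other basis brackets zero). -/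
open Module Submodule Filter Topology

/-- The filiform law `𝔤_{6,E}` on `ℂ⁶`: `[e₁,e_i] = e_{i+1}` for `2 ≤ i ≤ 5`,
`[e₂,e₃] = e₅`, `[e₂,e₄] = e₆`, `[e₂,e₅] = e₆`, `[e₃,e₄] = −e₆`. -/
noncomputable def g6ELaw : V 6 → V 6 → V 6 := fun x y =>
  ![0, 0,
    x 0 * y 1 - x 1 * y 0,
    x 0 * y 2 - x 2 * y 0,
    (x 0 * y 3 - x 3 * y 0) + (x 1 * y 2 - x 2 * y 1),
    (x 0 * y 4 - x 4 * y 0) + (x 1 * y 3 - x 3 * y 1)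
      + (x 1 * y 4 - x 4 * y 1) - (x 2 * y 3 - x 3 * y 2)]


/-! ### The closure of the orbit and its basic stability properties -/

/-- The closure of the orbit of `g6ELaw`. -/
def KK : Set (V 6 → V 6 → V 6) := closure (lieOrbit g6ELaw)

theorem act_mem_KK (g : V 6 ≃ₗ[ℂ] V 6) {μ : V 6 → V 6 → V 6} (h : μ ∈ KK) : act g μ ∈ KK := by
  have hc : Continuous (fun μ : V 6 → V 6 → V 6 => act g μ) := by
    refine continuous_pi fun x => continuous_pi fun y => ?_
    have hg : Continuous (g : V 6 → V 6) := LinearMap.continuous_of_finiteDimensional g.toLinearMap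
    exact hg.comp ((continuous_apply _).comp (continuous_apply _))
  refine map_mem_closure hc h ?_
  rintro ν ⟨k, rfl⟩
  exact ⟨k.trans g, by funext x y; simp [act]⟩

theorem conj_mem_KK {μ ν : V 6 → V 6 → V 6} (g : V 6 →ₗ[ℂ] V 6) (hg : Function.Injective g)
    (h : ∀ x y, g (μ x y) = ν (g x) (g y)) (hμ : μ ∈ KK) : ν ∈ KK := by
  let e := LinearEquiv.ofInjectiveEndo g hg
  have : ν = act e μ := by
    funext x y
    have h1 := h (e.symm x) (e.symm y)
    have h2 : ∀ z, g (e.symm z) = z := fun z => e.apply_symm_apply z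
    rw [h2, h2] at h1
    rw [← h1]; rfl
  rw [this]
  exact act_mem_KK e hμ

theorem limit_mem_KK (F : ℂ → V 6 → V 6 → V 6) (hF : Continuous F) (z₀ : ℂ)
    (h : ∀ z, z ≠ z₀ → F z ∈ KK) : F z₀ ∈ KK := by
  have h1 : Tendsto F (𝓝[≠] z₀) (𝓝 (F z₀)) := hF.continuousAt.mono_left nhdsWithin_le_nhds
  refine isClosed_closure.mem_of_tendsto h1 ?_
  exact eventually_nhdsWithin_of_forall fun z hz => h z hz

/-! ### The triangular family -/

/-- Triangular laws with respect to a flag whose top hyperplane centralizes `e₅`. -/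
def TT (a3 a4 a5 a6 b4 b5 b6 c4 c5 c6 d5 d6 f5 f6 g5 g6 p : ℂ) : V 6 → V 6 → V 6 := fun x y =>
  ![0, 0,
    a3 * (x 0 * y 1 - x 1 * y 0),
    a4 * (x 0 * y 1 - x 1 * y 0) + b4 * (x 0 * y 2 - x 2 * y 0) + c4 * (x 1 * y 2 - x 2 * y 1),
    a5 * (x 0 * y 1 - x 1 * y 0) + b5 * (x 0 * y 2 - x 2 * y 0) + c5 * (x 1 * y 2 - x 2 * y 1)
      + d5 * (x 0 * y 3 - x 3 * y 0) + f5 * (x 1 * y 3 - x 3 * y 1) + g5 * (x 2 * y 3 - x 3 * y 2),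
    a6 * (x 0 * y 1 - x 1 * y 0) + b6 * (x 0 * y 2 - x 2 * y 0) + c6 * (x 1 * y 2 - x 2 * y 1)
      + d6 * (x 0 * y 3 - x 3 * y 0) + f6 * (x 1 * y 3 - x 3 * y 1) + g6 * (x 2 * y 3 - x 3 * y 2)
      + p * (x 0 * y 4 - x 4 * y 0)]

theorem TT_continuous {a3 a4 a5 a6 b4 b5 b6 c4 c5 c6 d5 d6 f5 f6 g5 g6 p : ℂ → ℂ}
    (h1 : Continuous a3) (h2 : Continuous a4) (h3 : Continuous a5) (h4 : Continuous a6)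
    (h5 : Continuous b4) (h6 : Continuous b5) (h7 : Continuous b6)
    (h8 : Continuous c4) (h9 : Continuous c5) (h10 : Continuous c6)
    (h11 : Continuous d5) (h12 : Continuous d6) (h13 : Continuous f5) (h14 : Continuous f6)
    (h15 : Continuous g5) (h16 : Continuous g6) (h17 : Continuous p) :
    Continuous (fun t => TT (a3 t) (a4 t) (a5 t) (a6 t) (b4 t) (b5 t) (b6 t) (c4 t) (c5 t) (c6 t)
      (d5 t) (d6 t) (f5 t) (f6 t) (g5 t) (g6 t) (p t)) := by
  refine continuous_pi fun x => continuous_pi fun y => continuous_pi fun i => ?_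
  fin_cases i <;> simp [TT] <;> fun_prop

/-- The standard filiform laws. -/
theorem chain_mem (c4 c5 c6 : ℂ) : TT 1 0 0 0 1 0 0 c4 c5 c6 1 0 c4 c5 0 c4 1 ∈ KK := by
  have base : TT 1 0 0 0 1 0 0 (-1) 1 0 1 0 (-1) 1 0 (-1) 1 ∈ KK := by
    have h0 : g6ELaw ∈ KK :=
      subset_closure ⟨LinearEquiv.refl ℂ _, by funext x y; simp [act]⟩
    let g : V 6 →ₗ[ℂ] V 6 := Fintype.linearCombination ℂ
      ![![1, 0, 0, 0, 0, 0], ![1, 1, 0, 0, 0, 0], ![0, 0, 1, 0, 0, 0], ![0, 0, 0, 1, 0, 0],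
        ![0, 0, 0, 0, 1, 0], ![0, 0, 0, 0, 0, 1]]
    have hg : ∀ x, g x = ![x 0 + x 1, x 1, x 2, x 3, x 4, x 5] := by
      intro x
      ext i
      fin_cases i <;> simp [g, Fintype.linearCombination_apply, Fin.sum_univ_succ]
    refine conj_mem_KK g ?_ ?_ h0
    · rw [injective_iff_map_eq_zero]
      intro x hx
      rw [hg] at hx
      have e0 := congrFun hx 0
      have e1 := congrFun hx 1
      have e2 := congrFun hx 2
      have e3 := congrFun hx 3
      have e4 := congrFun hx 4
      have e5 := congrFun hx 5
      simp at e0 e1 e2 e3 e4 e5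
      rw [e1, add_zero] at e0
      ext i
      fin_cases i <;> simp [*]
    · intro x y
      rw [hg, hg, hg]
      ext i
      fin_cases i <;> simp [TT, g6ELaw] <;> ring
  have main : ∀ c4 c5 c6 : ℂ, c4 ≠ 0 → c5 ≠ 0 →
      TT 1 0 0 0 1 0 0 c4 c5 c6 1 0 c4 c5 0 c4 1 ∈ KK := by
    intro c4 c5 c6 h4 h5
    obtain ⟨l, hl⟩ := IsAlgClosed.exists_pow_nat_eq (-c6 / c4) (n := 2) (by norm_num)
    have hc6 : c6 = - l ^ 2 * c4 := by rw [hl]; field_simp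
    obtain ⟨α, hα⟩ : ∃ α, α = -c5 / c4 := ⟨_, rfl⟩
    have hα0 : α ≠ 0 := by rw [hα]; simp [h4, h5]
    have hc5 : c5 = - α * c4 := by rw [hα]; field_simp
    obtain ⟨β, hβ⟩ : ∃ β, β = -α / c4 := ⟨_, rfl⟩
    have hβ0 : β ≠ 0 := by rw [hβ]; simp [h4, hα0]
    have hbc : β * c4 = -α := by rw [hβ]; field_simp
    let g : V 6 →ₗ[ℂ] V 6 := Fintype.linearCombination ℂ
      ![![α, 0, 0, 0, 0, 0], ![0, β, β * l, 0, 0, 0], ![0, 0, α * β, α * β * l, 0, 0],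
        ![0, 0, 0, α ^ 2 * β, α ^ 2 * β * l, 0],
        ![0, 0, 0, 0, α ^ 3 * β, α ^ 3 * β * l], ![0, 0, 0, 0, 0, α ^ 4 * β]]
    have hg : ∀ x, g x = ![x 0 * α, x 1 * β, x 1 * (β * l) + x 2 * (α * β),
        x 2 * (α * β * l) + x 3 * (α ^ 2 * β), x 3 * (α ^ 2 * β * l) + x 4 * (α ^ 3 * β),
        x 4 * (α ^ 3 * β * l) + x 5 * (α ^ 4 * β)] := by
      intro x
      ext i
      fin_cases i <;> simp [g, Fintype.linearCombination_apply, Fin.sum_univ_succ]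
    refine conj_mem_KK g ?_ ?_ base
    · rw [injective_iff_map_eq_zero]
      intro x hx
      rw [hg] at hx
      have e0 := congrFun hx 0
      have e1 := congrFun hx 1
      have e2 := congrFun hx 2
      have e3 := congrFun hx 3
      have e4 := congrFun hx 4
      have e5 := congrFun hx 5
      simp [hα0, hβ0] at e0 e1
      simp [hα0, hβ0, e1] at e2
      simp [hα0, hβ0, e2] at e3
      simp [hα0, hβ0, e3] at e4
      simp [hα0, hβ0, e4] at e5
      ext i
      fin_cases i <;> simp [*]
    · intro x y
      rw [hg, hg, hg]
      subst hc6 hc5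
      have hα' : α = - (β * c4) := by rw [hbc]; ring
      clear_value g
      clear hg hα hβ hbc
      subst hα'
      ext i
      fin_cases i <;> simp [TT] <;> ring
  have step : ∀ c4 c5 c6 : ℂ, c4 ≠ 0 → TT 1 0 0 0 1 0 0 c4 c5 c6 1 0 c4 c5 0 c4 1 ∈ KK := by
    intro c4 c5 c6 h4
    by_cases h5 : c5 = 0
    · subst h5
      refine limit_mem_KK (fun t => TT 1 0 0 0 1 0 0 c4 t c6 1 0 c4 t 0 c4 1) ?_ 0 ?_
      · apply TT_continuous <;> fun_prop
      · intro z hz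
        exact main _ _ _ h4 hz
    · exact main _ _ _ h4 h5
  by_cases h4 : c4 = 0
  · subst h4
    refine limit_mem_KK (fun t => TT 1 0 0 0 1 0 0 t c5 c6 1 0 t c5 0 t 1) ?_ 0 ?_
    · apply TT_continuous <;> fun_prop
    · intro z hz
      exact step _ _ _ hz
  · exact step _ _ _ h4

/-- Triangular laws for which `ad e₁` is regular. -/
theorem regular_mem (a3 a4 a5 a6 b4 b5 b6 c4 c5 c6 d5 d6 f5 f6 g6 p : ℂ)
    (hA : c4 * d5 = b4 * f5) (hB : f5 * p = a3 * g6)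
    (hE : c4 * d6 + c5 * p - b4 * f6 + a4 * g6 = 0)
    (ha : a3 ≠ 0) (hb : b4 ≠ 0) (hd : d5 ≠ 0) (hp : p ≠ 0) :
    TT a3 a4 a5 a6 b4 b5 b6 c4 c5 c6 d5 d6 f5 f6 0 g6 p ∈ KK := by
  -- coordinates of the chain basis
  obtain ⟨u5, hu5⟩ : ∃ u, u = a3 * b5 + a4 * d5 := ⟨_, rfl⟩
  obtain ⟨u6, hu6⟩ : ∃ u, u = a3 * b6 + a4 * d6 + a5 * p := ⟨_, rfl⟩
  obtain ⟨v6, hv6⟩ : ∃ u, u = a3 * b4 * d6 + u5 * p := ⟨_, rfl⟩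
  obtain ⟨γ4, h4⟩ : ∃ u, c4 = u * b4 := ⟨c4 / b4, by field_simp⟩
  obtain ⟨γ5, h5⟩ : ∃ u, a3 * c5 + a4 * f5 = γ4 * u5 + u * (a3 * b4 * d5) :=
    ⟨(a3 * c5 + a4 * f5 - γ4 * u5) / (a3 * b4 * d5), by field_simp; ring⟩
  obtain ⟨γ6, h6⟩ : ∃ u, a3 * c6 + a4 * f6 = γ4 * u6 + γ5 * v6 + u * (a3 * b4 * d5 * p) :=
    ⟨(a3 * c6 + a4 * f6 - γ4 * u6 - γ5 * v6) / (a3 * b4 * d5 * p), by field_simp; ring⟩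
  have hf5 : f5 = γ4 * d5 := by
    apply mul_left_cancel₀ hb; rw [← hA, h4]; ring
  have hg6 : a3 * g6 = γ4 * d5 * p := by rw [← hB, hf5]
  have hf6 : a3 * b4 * f6 = γ4 * v6 + γ5 * (a3 * b4 * d5 * p) := by
    rw [h4] at hE
    rw [hf5] at h5
    linear_combination (-a3) * hE + p * h5 + a4 * hg6 - γ4 * hv6
  let g : V 6 →ₗ[ℂ] V 6 := Fintype.linearCombination ℂ
    ![![1, 0, 0, 0, 0, 0], ![0, 1, 0, 0, 0, 0], ![0, 0, a3, a4, a5, a6],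
      ![0, 0, 0, a3 * b4, u5, u6],
      ![0, 0, 0, 0, a3 * b4 * d5, v6], ![0, 0, 0, 0, 0, a3 * b4 * d5 * p]]
  have hg : ∀ x, g x = ![x 0, x 1, x 2 * a3, x 2 * a4 + x 3 * (a3 * b4),
      x 2 * a5 + (x 3 * u5 + x 4 * (a3 * b4 * d5)),
      x 2 * a6 + (x 3 * u6 + (x 4 * v6 + x 5 * (a3 * b4 * d5 * p)))] := by
    intro x
    ext i
    fin_cases i <;> simp [g, Fintype.linearCombination_apply, Fin.sum_univ_succ]
  refine conj_mem_KK g ?_ ?_ (chain_mem γ4 γ5 γ6)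
  · rw [injective_iff_map_eq_zero]
    intro x hx
    rw [hg] at hx
    have e0 := congrFun hx 0
    have e1 := congrFun hx 1
    have e2 := congrFun hx 2
    have e3 := congrFun hx 3
    have e4 := congrFun hx 4
    have e5 := congrFun hx 5
    simp [ha] at e0 e1 e2
    simp [ha, hb, e2] at e3
    simp [ha, hb, hd, e2, e3] at e4
    simp [ha, hb, hd, hp, e2, e3, e4] at e5
    ext i
    fin_cases i <;> simp [*]
  · intro x y
    rw [hg, hg, hg]
    ext i
    fin_cases i
    · simp [TT]
    · simp [TT]
    · simp [TT]; ring
    · simp [TT, h4]; ring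
    · simp [TT]
      linear_combination (-(x 1 * y 2 - x 2 * y 1)) * h5
        + (x 0 * y 2 - x 2 * y 0) * hu5 - (x 1 * y 3 - x 3 * y 1) * a3 * b4 * hf5
    · simp [TT]
      linear_combination (-(x 1 * y 2 - x 2 * y 1)) * h6
        + (x 0 * y 2 - x 2 * y 0) * hu6 + (x 0 * y 3 - x 3 * y 0) * hv6
        - (x 1 * y 3 - x 3 * y 1) * hf6 - (x 2 * y 3 - x 3 * y 2) * a3 * b4 * hg6

/-! ### Perturbation arguments -/

/-- The family of triangular laws with `p ≠ 0`, with `c₅`, `f₅` eliminated. -/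
noncomputable def PP (a4 a5 a6 b5 b6 c6 d6 f6 p : ℂ) (a3 b4 c4 d5 g6 : ℂ) : V 6 → V 6 → V 6 :=
  TT a3 a4 a5 a6 b4 b5 b6 c4 ((b4 * f6 - c4 * d6 - a4 * g6) / p) c6 d5 d6 (a3 * g6 / p) f6 0 g6 p

theorem PP_continuous (a4 a5 a6 b5 b6 c6 d6 f6 p : ℂ) {a3 b4 c4 d5 g6 : ℂ → ℂ}
    (h1 : Continuous a3) (h5 : Continuous b4) (h8 : Continuous c4) (h11 : Continuous d5)
    (h16 : Continuous g6) : Continuous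
      (fun t => PP a4 a5 a6 b5 b6 c6 d6 f6 p (a3 t) (b4 t) (c4 t) (d5 t) (g6 t)) := by
  unfold PP
  apply TT_continuous <;> fun_prop

theorem PP_mem (a4 a5 a6 b5 b6 c6 d6 f6 p : ℂ) (hp : p ≠ 0) (a3 b4 c4 d5 g6 : ℂ)
    (h : c4 * d5 * p = b4 * a3 * g6) : PP a4 a5 a6 b5 b6 c6 d6 f6 p a3 b4 c4 d5 g6 ∈ KK := by
  have reg : ∀ a3 b4 c4 d5 g6 : ℂ, c4 * d5 * p = b4 * a3 * g6 → a3 ≠ 0 → b4 ≠ 0 → d5 ≠ 0 →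
      PP a4 a5 a6 b5 b6 c6 d6 f6 p a3 b4 c4 d5 g6 ∈ KK := by
    intro a3 b4 c4 d5 g6 h ha hb hd
    refine regular_mem _ _ _ _ _ _ _ _ _ _ _ _ _ _ _ _ ?_ ?_ ?_ ha hb hd hp
    · field_simp
      linear_combination h
    · field_simp
    · field_simp
      ring
  -- the case `d5 ≠ 0`, with `c4` eliminated
  have hd : ∀ a3 b4 d5 g6 : ℂ, d5 ≠ 0 →
      PP a4 a5 a6 b5 b6 c6 d6 f6 p a3 b4 (b4 * a3 * g6 / (d5 * p)) d5 g6 ∈ KK := by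
    have s1 : ∀ a3 b4 d5 g6 : ℂ, d5 ≠ 0 → a3 ≠ 0 →
        PP a4 a5 a6 b5 b6 c6 d6 f6 p a3 b4 (b4 * a3 * g6 / (d5 * p)) d5 g6 ∈ KK := by
      intro a3 b4 d5 g6 hd ha
      by_cases hb : b4 = 0
      · subst hb
        refine limit_mem_KK
          (fun z => PP a4 a5 a6 b5 b6 c6 d6 f6 p a3 z (z * a3 * g6 / (d5 * p)) d5 g6) ?_ 0 ?_
        · apply PP_continuous <;> fun_prop
        · intro z hz
          exact reg _ _ _ _ _ (by rw [mul_assoc]; exact div_mul_cancel₀ _ (mul_ne_zero hd hp))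
            ha hz hd
      · exact reg _ _ _ _ _ (by rw [mul_assoc]; exact div_mul_cancel₀ _ (mul_ne_zero hd hp))
          ha hb hd
    intro a3 b4 d5 g6 hd
    by_cases ha : a3 = 0
    · subst ha
      refine limit_mem_KK
        (fun z => PP a4 a5 a6 b5 b6 c6 d6 f6 p z b4 (b4 * z * g6 / (d5 * p)) d5 g6) ?_ 0 ?_
      · apply PP_continuous <;> fun_prop
      · intro z hz
        exact s1 _ _ _ _ hd hz
    · exact s1 _ _ _ _ hd ha
  have hd' : ∀ a3 b4 c4 d5 g6 : ℂ, c4 * d5 * p = b4 * a3 * g6 → d5 ≠ 0 →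
      PP a4 a5 a6 b5 b6 c6 d6 f6 p a3 b4 c4 d5 g6 ∈ KK := by
    intro a3 b4 c4 d5 g6 h h0
    have : c4 = b4 * a3 * g6 / (d5 * p) := by
      field_simp
      linear_combination h
    rw [this]
    exact hd _ _ _ _ h0
  -- the case `c4 ≠ 0`, with `d5` eliminated
  have hc : ∀ a3 b4 c4 g6 : ℂ, c4 ≠ 0 →
      PP a4 a5 a6 b5 b6 c6 d6 f6 p a3 b4 c4 (b4 * a3 * g6 / (c4 * p)) g6 ∈ KK := by
    have s3 : ∀ a3 b4 c4 g6 : ℂ, c4 ≠ 0 → a3 ≠ 0 → b4 ≠ 0 → g6 ≠ 0 →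
        PP a4 a5 a6 b5 b6 c6 d6 f6 p a3 b4 c4 (b4 * a3 * g6 / (c4 * p)) g6 ∈ KK := by
      intro a3 b4 c4 g6 hc ha hb hg
      exact hd' _ _ _ _ _ (by field_simp) (by simp [*])
    have s2 : ∀ a3 b4 c4 g6 : ℂ, c4 ≠ 0 → a3 ≠ 0 → b4 ≠ 0 →
        PP a4 a5 a6 b5 b6 c6 d6 f6 p a3 b4 c4 (b4 * a3 * g6 / (c4 * p)) g6 ∈ KK := by
      intro a3 b4 c4 g6 hc ha hb
      by_cases hg : g6 = 0
      · subst hg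
        refine limit_mem_KK
          (fun z => PP a4 a5 a6 b5 b6 c6 d6 f6 p a3 b4 c4 (b4 * a3 * z / (c4 * p)) z) ?_ 0 ?_
        · apply PP_continuous <;> fun_prop
        · intro z hz
          exact s3 _ _ _ _ hc ha hb hz
      · exact s3 _ _ _ _ hc ha hb hg
    have s1 : ∀ a3 b4 c4 g6 : ℂ, c4 ≠ 0 → a3 ≠ 0 →
        PP a4 a5 a6 b5 b6 c6 d6 f6 p a3 b4 c4 (b4 * a3 * g6 / (c4 * p)) g6 ∈ KK := by
      intro a3 b4 c4 g6 hc ha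
      by_cases hb : b4 = 0
      · subst hb
        refine limit_mem_KK
          (fun z => PP a4 a5 a6 b5 b6 c6 d6 f6 p a3 z c4 (z * a3 * g6 / (c4 * p)) g6) ?_ 0 ?_
        · apply PP_continuous <;> fun_prop
        · intro z hz
          exact s2 _ _ _ _ hc ha hz
      · exact s2 _ _ _ _ hc ha hb
    intro a3 b4 c4 g6 hc
    by_cases ha : a3 = 0
    · subst ha
      refine limit_mem_KK
        (fun z => PP a4 a5 a6 b5 b6 c6 d6 f6 p z b4 c4 (b4 * z * g6 / (c4 * p)) g6) ?_ 0 ?_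
      · apply PP_continuous <;> fun_prop
      · intro z hz
        exact s1 _ _ _ _ hc hz
    · exact s1 _ _ _ _ hc ha
  by_cases hd5 : d5 = 0
  · by_cases hc4 : c4 = 0
    · subst hd5 hc4
      refine limit_mem_KK (fun z => PP a4 a5 a6 b5 b6 c6 d6 f6 p a3 b4 0 z g6) ?_ 0 ?_
      · apply PP_continuous <;> fun_prop
      · intro z hz
        exact hd' _ _ _ _ _ (by linear_combination h) hz
    · have : d5 = b4 * a3 * g6 / (c4 * p) := by
        field_simp
        linear_combination h
      rw [this]
      exact hc _ _ _ _ hc4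
  · exact hd' _ _ _ _ _ h hd5

theorem pne_mem (a3 a4 a5 a6 b4 b5 b6 c4 c5 c6 d5 d6 f5 f6 g6 p : ℂ)
    (hA : c4 * d5 = b4 * f5) (hB : f5 * p = a3 * g6)
    (hE : c4 * d6 + c5 * p - b4 * f6 + a4 * g6 = 0) (hp : p ≠ 0) :
    TT a3 a4 a5 a6 b4 b5 b6 c4 c5 c6 d5 d6 f5 f6 0 g6 p ∈ KK := by
  have h1 : f5 = a3 * g6 / p := by field_simp; exact hB
  have h2 : c5 = (b4 * f6 - c4 * d6 - a4 * g6) / p := by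
    field_simp
    linear_combination hE
  have := PP_mem a4 a5 a6 b5 b6 c6 d6 f6 p hp a3 b4 c4 d5 g6
    (by linear_combination p * hA + b4 * hB)
  rw [PP, ← h1, ← h2] at this
  exact this

/-- The case where `e₅` and `e₆` are both central. -/
theorem pzero_mem (a3 a4 a5 a6 b4 b5 b6 c5 c6 d5 d6 f5 f6 : ℂ)
    (hA : b4 * f5 = 0) (hE : b4 * f6 = 0) :
    TT a3 a4 a5 a6 b4 b5 b6 0 c5 c6 d5 d6 f5 f6 0 0 0 ∈ KK := by
  by_cases hb : b4 = 0
  · subst hb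
    have s3 : ∀ a3 d5 f6 : ℂ, a3 ≠ 0 → d5 ≠ 0 → f5 * d6 - f6 * d5 ≠ 0 →
        TT a3 a4 a5 a6 0 b5 b6 0 c5 c6 d5 d6 f5 f6 0 0 0 ∈ KK := by
      intro a3 d5 f6 ha hd hD
      obtain ⟨k, hk⟩ : ∃ k, k * (f5 * d6 - f6 * d5) * a3 = - (c5 * a3 + a4 * f5) * d5 :=
        ⟨- (c5 * a3 + a4 * f5) * d5 / ((f5 * d6 - f6 * d5) * a3),
          by rw [mul_assoc]; exact div_mul_cancel₀ _ (mul_ne_zero hD ha)⟩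
      have := limit_mem_KK (fun t => TT a3 a4 a5 a6 (k * t) b5 b6 (k * t * f5 / d5) c5 c6 d5 d6
        f5 f6 0 (f5 * t / a3) t) (by apply TT_continuous <;> fun_prop) 0 (by
          intro t ht
          refine pne_mem _ _ _ _ _ _ _ _ _ _ _ _ _ _ _ _ ?_ ?_ ?_ ht
          · field_simp
          · field_simp
          · field_simp
            linear_combination t * hk)
      simpa using this
    have s2 : ∀ a3 d5 f6 : ℂ, a3 ≠ 0 → d5 ≠ 0 →
        TT a3 a4 a5 a6 0 b5 b6 0 c5 c6 d5 d6 f5 f6 0 0 0 ∈ KK := by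
      intro a3 d5 f6 ha hd
      by_cases hD : f5 * d6 - f6 * d5 = 0
      · refine limit_mem_KK (fun t => TT a3 a4 a5 a6 0 b5 b6 0 c5 c6 d5 d6 f5 t 0 0 0)
          (by apply TT_continuous <;> fun_prop) f6 ?_
        intro t ht
        refine s3 _ _ _ ha hd fun h0 => ht ?_
        apply mul_right_cancel₀ hd
        linear_combination hD - h0
      · exact s3 _ _ _ ha hd hD
    have s1 : ∀ a3 d5 f6 : ℂ, a3 ≠ 0 →
        TT a3 a4 a5 a6 0 b5 b6 0 c5 c6 d5 d6 f5 f6 0 0 0 ∈ KK := by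
      intro a3 d5 f6 ha
      by_cases hd : d5 = 0
      · subst hd
        exact limit_mem_KK (fun t => TT a3 a4 a5 a6 0 b5 b6 0 c5 c6 t d6 f5 f6 0 0 0)
          (by apply TT_continuous <;> fun_prop) 0 (fun t ht => s2 _ _ _ ha ht)
      · exact s2 _ _ _ ha hd
    by_cases ha : a3 = 0
    · subst ha
      exact limit_mem_KK (fun t => TT t a4 a5 a6 0 b5 b6 0 c5 c6 d5 d6 f5 f6 0 0 0)
        (by apply TT_continuous <;> fun_prop) 0 (fun t ht => s1 _ _ _ ht)
    · exact s1 _ _ _ ha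
  · obtain rfl : f5 = 0 := by simpa [hb] using hA
    obtain rfl : f6 = 0 := by simpa [hb] using hE
    have := limit_mem_KK (fun t => TT a3 a4 a5 a6 b4 b5 b6 0 c5 c6 d5 d6
        0 (c5 * t / b4) 0 0 t) (by apply TT_continuous <;> fun_prop) 0 (by
          intro t ht
          refine pne_mem _ _ _ _ _ _ _ _ _ _ _ _ _ _ _ _ ?_ ?_ ?_ ht
          · simp
          · simp
          · field_simp
            ring)
    simpa using this

/-! ### Passing from an adapted basis to the triangular family -/

/-- The bundled bilinear map of a law. -/
def IsLieLaw.bil {n : ℕ} {μ : V n → V n → V n} (h : IsLieLaw μ) : V n →ₗ[ℂ] V n →ₗ[ℂ] V n :=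
  LinearMap.mk₂ ℂ μ
    (fun x y z => by simpa using h.1 1 x y z)
    (fun a x z => by
      have h0 : μ 0 z = 0 := by simpa using h.1 1 0 0 z
      simpa [h0] using h.1 a x 0 z)
    (fun x y z => by simpa using h.2.1 1 x y z)
    (fun a x z => by
      have h0 : μ x 0 = 0 := by simpa using h.2.1 1 x 0 0
      simpa [h0] using h.2.1 a x z 0)

theorem IsLieLaw.bil_apply {n : ℕ} {μ : V n → V n → V n} (h : IsLieLaw μ) (x y : V n) :
    h.bil x y = μ x y := rfl

theorem IsLieLaw.bil_skew {n : ℕ} {μ : V n → V n → V n} (h : IsLieLaw μ) (x y : V n) :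
    h.bil x y = - h.bil y x := by
  have h1 : h.bil (x + y) (x + y) = 0 := h.2.2.1 _
  have h2 : h.bil x x = 0 := h.2.2.1 _
  have h3 : h.bil y y = 0 := h.2.2.1 _
  simp only [map_add, LinearMap.add_apply, h2, h3, zero_add, add_zero] at h1
  exact eq_neg_of_add_eq_zero_left (by rw [add_comm]; exact h1)

theorem frame_mem {μ : V 6 → V 6 → V 6} (h : IsLieLaw μ) (e0 e1 e2 e3 e4 e5 : V 6)
    (hli : LinearIndependent ℂ ![e0, e1, e2, e3, e4, e5])
    (a3 a4 a5 a6 b4 b5 b6 c4 c5 c6 d5 d6 f5 f6 g5 g6 p : ℂ)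
    (h01 : μ e0 e1 = a3 • e2 + a4 • e3 + a5 • e4 + a6 • e5)
    (h02 : μ e0 e2 = b4 • e3 + b5 • e4 + b6 • e5)
    (h12 : μ e1 e2 = c4 • e3 + c5 • e4 + c6 • e5)
    (h03 : μ e0 e3 = d5 • e4 + d6 • e5)
    (h13 : μ e1 e3 = f5 • e4 + f6 • e5)
    (h23 : μ e2 e3 = g5 • e4 + g6 • e5)
    (h04 : μ e0 e4 = p • e5) (h14 : μ e1 e4 = 0) (h24 : μ e2 e4 = 0) (h34 : μ e3 e4 = 0)
    (h5 : ∀ x, μ x e5 = 0)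
    (hcase : p ≠ 0 ∨ (p = 0 ∧ c4 = 0 ∧ g5 = 0 ∧ g6 = 0)) : μ ∈ KK := by
  let g : V 6 →ₗ[ℂ] V 6 := Fintype.linearCombination ℂ ![e0, e1, e2, e3, e4, e5]
  have hg : ∀ x, g x = x 0 • e0 + x 1 • e1 + x 2 • e2 + x 3 • e3 + x 4 • e4 + x 5 • e5 := by
    intro x
    simp only [g, Fintype.linearCombination_apply, Fin.sum_univ_six]
    rfl
  have hinj : Function.Injective g :=
    hli.fintypeLinearCombination_injective
  have hconj : ∀ x y, g (TT a3 a4 a5 a6 b4 b5 b6 c4 c5 c6 d5 d6 f5 f6 g5 g6 p x y)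
      = μ (g x) (g y) := by
    intro x y
    rw [← h.bil_apply, hg, hg, hg]
    have k : ∀ x, h.bil x x = 0 := h.2.2.1
    simp only [← h.bil_apply] at h01 h02 h12 h03 h13 h23 h04 h14 h24 h34 h5
    have h5' : ∀ x, h.bil e5 x = 0 := fun x => by rw [h.bil_skew, h5, neg_zero]
    simp only [map_add, map_smul, LinearMap.add_apply, LinearMap.smul_apply, k, h5, h5',
      h.bil_skew e1 e0, h.bil_skew e2 e0, h.bil_skew e2 e1, h.bil_skew e3 e0, h.bil_skew e3 e1,
      h.bil_skew e3 e2, h.bil_skew e4 e0, h.bil_skew e4 e1, h.bil_skew e4 e2, h.bil_skew e4 e3,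
      h01, h02, h12, h03, h13, h23, h04, h14, h24, h34]
    simp only [TT, Matrix.cons_val]
    module
  set T := TT a3 a4 a5 a6 b4 b5 b6 c4 c5 c6 d5 d6 f5 f6 g5 g6 p with hT
  have hJ : ∀ x y z, T x (T y z) + T y (T z x) + T z (T x y) = 0 := by
    intro x y z
    apply hinj
    simp only [map_add, hconj, map_zero]
    exact h.2.2.2 _ _ _
  refine conj_mem_KK g hinj hconj ?_
  have J012 := hJ ![1, 0, 0, 0, 0, 0] ![0, 1, 0, 0, 0, 0] ![0, 0, 1, 0, 0, 0]
  have J013 := hJ ![1, 0, 0, 0, 0, 0] ![0, 1, 0, 0, 0, 0] ![0, 0, 0, 1, 0, 0]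
  have J023 := hJ ![1, 0, 0, 0, 0, 0] ![0, 0, 1, 0, 0, 0] ![0, 0, 0, 1, 0, 0]
  have qA := congrFun J012 4
  have qE := congrFun J012 5
  have qB := congrFun J013 5
  have qC := congrFun J023 5
  simp [hT, TT] at qA qE qB qC
  rw [hT]
  rcases hcase with hp | ⟨rfl, rfl, rfl, rfl⟩
  · have hg5 : g5 = 0 := by
      rcases qC with h | h
      · exact absurd h hp
      · exact h
    subst hg5
    refine pne_mem _ _ _ _ _ _ _ _ _ _ _ _ _ _ _ _ ?_ ?_ ?_ hp
    · linear_combination qA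
    · linear_combination qB
    · linear_combination qE
  · refine pzero_mem _ _ _ _ _ _ _ _ _ _ _ _ _ ?_ ?_
    · simpa [or_comm] using qA
    · simpa [or_comm] using qE

/-! ### Existence of adapted bases -/

theorem exists_central_mod {μ : V 6 → V 6 → V 6} (hn : IsNilpotentLaw μ)
    (W U : Submodule ℂ (V 6)) (hW : ∀ x, ∀ w ∈ W, μ x w ∈ W) (hWU : ¬ W ≤ U) :
    ∃ w ∈ W, w ∉ U ∧ ∀ x, μ x w ∈ U := by
  by_contra hcon
  push Not at hcon
  obtain ⟨k, hk⟩ := hn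
  have claim : ∀ k, ∃ w ∈ W, w ∈ lcs μ k ∧ w ∉ U := by
    intro k
    induction k with
    | zero =>
      obtain ⟨w, hw, hwU⟩ := Set.not_subset.mp hWU
      exact ⟨w, hw, by simp [lcs], hwU⟩
    | succ k ih =>
      obtain ⟨w, hw, hwk, hwU⟩ := ih
      obtain ⟨x, hx⟩ := hcon w hw hwU
      exact ⟨μ x w, hW x w hw, Submodule.subset_span ⟨x, w, hwk, rfl⟩, hx⟩
  obtain ⟨w, _, hwk, hwU⟩ := claim k
  rw [hk, Submodule.mem_bot] at hwk
  exact hwU (hwk ▸ U.zero_mem)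

theorem ker_big {M : Type*} [AddCommGroup M] [Module ℂ M] (f : V 6 →ₗ[ℂ] M) (s : Finset M) (k : ℕ)
    (hs : s.card ≤ k) (h : ∀ x, f x ∈ span ℂ (s : Set M)) :
    6 ≤ k + finrank ℂ (LinearMap.ker f) := by
  have h1 := LinearMap.finrank_range_add_finrank_ker f
  have h2 : finrank ℂ (LinearMap.range f) ≤ finrank ℂ (span ℂ (s : Set M)) := by
    have : FiniteDimensional ℂ (span ℂ (s : Set M)) :=
      FiniteDimensional.span_of_finite ℂ s.finite_toSet
    apply Submodule.finrank_mono
    rintro _ ⟨x, rfl⟩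
    exact h x
  have h3 : finrank ℂ (span ℂ (s : Set M)) ≤ s.card := finrank_span_finset_le_card (R := ℂ) s
  have h4 : finrank ℂ (V 6) = 6 := by simp
  omega

theorem not_le_span {W : Submodule ℂ (V 6)} (s : Finset (V 6)) (k : ℕ) (hs : s.card ≤ k)
    (hk : k < finrank ℂ W) : ¬ W ≤ span ℂ (s : Set (V 6)) := by
  intro hle
  have h2 := Submodule.finrank_mono hle
  have h3 := finrank_span_finset_le_card (R := ℂ) s
  have h4 : finrank ℂ (span ℂ (s : Set (V 6))) ≤ s.card := h3
  omega

theorem li_six {e0 e1 e2 e3 e4 e5 : V 6} (h5 : e5 ≠ 0) (h4 : e4 ∉ span ℂ {e5})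
    (h3 : e3 ∉ span ℂ {e4, e5}) (h2 : e2 ∉ span ℂ {e3, e4, e5})
    (h1 : e1 ∉ span ℂ {e2, e3, e4, e5}) (h0 : e0 ∉ span ℂ {e1, e2, e3, e4, e5}) :
    LinearIndependent ℂ ![e0, e1, e2, e3, e4, e5] := by
  refine linearIndependent_finCons.2 ⟨linearIndependent_finCons.2 ⟨linearIndependent_finCons.2
    ⟨linearIndependent_finCons.2 ⟨linearIndependent_finCons.2 ⟨?_, ?_⟩, ?_⟩, ?_⟩, ?_⟩, ?_⟩
  · exact linearIndependent_unique_iff.2 h5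
  all_goals
    simpa only [Matrix.range_cons, Matrix.range_empty, Set.union_empty, Set.singleton_union]

theorem mem_span_four {x a b c d : V 6} (h : x ∈ span ℂ {a, b, c, d}) :
    ∃ r s t u : ℂ, x = r • a + s • b + t • c + u • d := by
  obtain ⟨r, z, hz, rfl⟩ := Submodule.mem_span_insert.mp h
  obtain ⟨s, t, u, rfl⟩ := Submodule.mem_span_triple.mp hz
  exact ⟨r, s, t, u, by module⟩

theorem nilpotent_mem {μ : V 6 → V 6 → V 6} (h : IsLieLaw μ) (hn : IsNilpotentLaw μ) :
    μ ∈ KK := by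
  classical
  have skew : ∀ x y, μ x y = - μ y x := fun x y => h.bil_skew x y
  have jac : ∀ x y z, μ (μ x y) z = μ x (μ y z) - μ y (μ x z) := by
    intro x y z
    have h1 := h.2.2.2 x y z
    rw [skew z (μ x y), skew z x] at h1
    have h2 : μ y (- μ x z) = - μ y (μ x z) := (h.bil y).map_neg _
    rw [h2] at h1
    rw [eq_comm, ← sub_eq_zero, ← h1]
    abel
  have top4 : finrank ℂ (⊤ : Submodule ℂ (V 6)) = 6 := by simp
  -- `e₆`
  obtain ⟨e5, -, he5, hc5⟩ := exists_central_mod hn ⊤ ⊥ (by simp) (by simp)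
  simp only [Submodule.mem_bot] at he5 hc5
  -- `e₅`
  obtain ⟨e4, -, he4, hc4⟩ := exists_central_mod hn ⊤ (span ℂ {e5}) (by simp) (by
    simpa using not_le_span (W := ⊤) {e5} 1 (by simp) (by simp))
  have e34 : ∀ x, ∃ a : ℂ, μ x e4 = a • e5 := fun x => by
    obtain ⟨a, ha⟩ := Submodule.mem_span_singleton.mp (hc4 x)
    exact ⟨a, ha.symm⟩
  by_cases hcen : ∀ x, μ x e4 = 0
  · -- both central
    have hI2 : ∀ x y, y ∈ span ℂ {e4, e5} → μ x y = 0 := by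
      intro x y hy
      obtain ⟨a, b, rfl⟩ := Submodule.mem_span_pair.mp hy
      have h1 : h.bil x (a • e4 + b • e5) = 0 := by
        rw [map_add, map_smul, map_smul, h.bil_apply, h.bil_apply, hcen, hc5]
        simp
      exact h1
    obtain ⟨e3, -, he3, hc3⟩ := exists_central_mod hn ⊤ (span ℂ {e4, e5}) (by simp) (by
      simpa using not_le_span (W := ⊤) {e4, e5} 2 Finset.card_le_two (by simp))
    let Z4 := LinearMap.ker (h.bil.flip e3)
    have mZ4 : ∀ x, x ∈ Z4 ↔ μ x e3 = 0 := fun x => Iff.rfl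
    have dZ4 : 6 ≤ 2 + finrank ℂ Z4 := ker_big (h.bil.flip e3) {e4, e5} 2 Finset.card_le_two (by
      intro x
      simpa [h.bil_apply] using hc3 x)
    obtain ⟨e2, hz2, he2, hc2⟩ := exists_central_mod hn Z4 (span ℂ {e3, e4, e5}) (by
      intro x w hw
      rw [mZ4] at hw ⊢
      rw [jac, hw, hI2 w _ (hc3 x), hI2 x 0 (Submodule.zero_mem _), sub_zero]) (by
      simpa using not_le_span (W := Z4) {e3, e4, e5} 3 Finset.card_le_three (by omega))
    let Z3 := LinearMap.ker ((span ℂ {e4, e5}).mkQ ∘ₗ h.bil.flip e2)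
    have mZ3 : ∀ x, x ∈ Z3 ↔ μ x e2 ∈ span ℂ {e4, e5} := fun x => by
      simp only [Z3, LinearMap.mem_ker, LinearMap.comp_apply, Submodule.mkQ_apply,
        Submodule.Quotient.mk_eq_zero]
      rfl
    have dZ3 : 6 ≤ 1 + finrank ℂ Z3 := ker_big ((span ℂ {e4, e5}).mkQ ∘ₗ h.bil.flip e2)
      {(span ℂ {e4, e5}).mkQ e3} 1 (by simp) (by
      intro x
      obtain ⟨a, b, c, hab⟩ := Submodule.mem_span_triple.mp (hc2 x)
      rw [Finset.coe_singleton, Submodule.mem_span_singleton]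
      refine ⟨a, ?_⟩
      rw [← map_smul, LinearMap.comp_apply, ← sub_eq_zero, ← map_sub, Submodule.mkQ_apply,
        Submodule.Quotient.mk_eq_zero]
      have h1 : h.bil.flip e2 x = a • e3 + b • e4 + c • e5 := hab.symm
      rw [h1]
      exact Submodule.mem_span_pair.mpr ⟨-b, -c, by module⟩)
    have hI3 : ∀ x y, y ∈ span ℂ {e3, e4, e5} → μ x y ∈ span ℂ {e4, e5} := by
      intro x y hy
      obtain ⟨a, b, c, rfl⟩ := Submodule.mem_span_triple.mp hy
      have h1 : h.bil x (a • e3 + b • e4 + c • e5) = a • μ x e3 := by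
        rw [map_add, map_add, map_smul, map_smul, map_smul, h.bil_apply, h.bil_apply, h.bil_apply,
          hcen, hc5]
        simp
      rw [← h.bil_apply, h1]
      exact Submodule.smul_mem _ _ (hc3 x)
    obtain ⟨e1, hz1, he1, hc1⟩ := exists_central_mod hn Z3 (span ℂ {e2, e3, e4, e5}) (by
      intro x w hw
      rw [mZ3] at hw ⊢
      rw [jac, hI2 x _ hw]
      exact Submodule.sub_mem _ (Submodule.zero_mem _) (hI3 _ _ (hc2 x))) (by
      simpa using not_le_span (W := Z3) {e2, e3, e4, e5} 4 Finset.card_le_four (by omega))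
    obtain ⟨e0, -, he0, -⟩ := exists_central_mod hn ⊤ (span ℂ {e1, e2, e3, e4, e5}) (by simp) (by
      simpa using not_le_span (W := ⊤) {e1, e2, e3, e4, e5} 5 Finset.card_le_five (by simp))
    obtain ⟨a3, a4, a5, a6, h01⟩ := mem_span_four (hc1 e0)
    obtain ⟨b4, b5, b6, h02⟩ := Submodule.mem_span_triple.mp (hc2 e0)
    obtain ⟨c5, c6, h12⟩ := Submodule.mem_span_pair.mp ((mZ3 e1).mp hz1)
    obtain ⟨d5, d6, h03⟩ := Submodule.mem_span_pair.mp (hc3 e0)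
    obtain ⟨f5, f6, h13⟩ := Submodule.mem_span_pair.mp (hc3 e1)
    have h23 := (mZ4 e2).mp hz2
    exact frame_mem h e0 e1 e2 e3 e4 e5 (li_six he5 he4 he3 he2 he1 he0)
      a3 a4 a5 a6 b4 b5 b6 0 c5 c6 d5 d6 f5 f6 0 0 0 h01 h02.symm (by rw [← h12]; module) h03.symm
      h13.symm (by rw [h23]; module) (by rw [hcen]; module) (hcen _) (hcen _) (hcen _) hc5
      (Or.inr ⟨rfl, rfl, rfl, rfl⟩)
  · push Not at hcen
    obtain ⟨e0, hne⟩ := hcen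
    obtain ⟨p, hp⟩ := e34 e0
    have hp0 : p ≠ 0 := by
      rintro rfl
      exact hne (by rw [hp, zero_smul])
    let Z := LinearMap.ker (h.bil.flip e4)
    have mZ : ∀ x, x ∈ Z ↔ μ x e4 = 0 := fun x => Iff.rfl
    have dZ : 6 ≤ 1 + finrank ℂ Z := ker_big (h.bil.flip e4) {e5} 1 (by simp) (by
      intro x
      simpa [h.bil_apply] using hc4 x)
    have hZ : ∀ x, ∀ w ∈ Z, μ x w ∈ Z := by
      intro x w hw
      rw [mZ] at hw ⊢
      obtain ⟨a, ha⟩ := e34 x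
      have h1 : μ w (a • e5) = a • μ w e5 := (h.bil w).map_smul _ _
      have h2 : μ x 0 = 0 := (h.bil x).map_zero
      rw [jac, hw, ha, h1, h2, hc5, smul_zero, sub_zero]
    obtain ⟨e3, hz3, he3, hc3⟩ := exists_central_mod hn Z (span ℂ {e4, e5}) hZ (by
      simpa using not_le_span (W := Z) {e4, e5} 2 Finset.card_le_two (by omega))
    obtain ⟨e2, hz2, he2, hc2⟩ := exists_central_mod hn Z (span ℂ {e3, e4, e5}) hZ (by
      simpa using not_le_span (W := Z) {e3, e4, e5} 3 Finset.card_le_three (by omega))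
    obtain ⟨e1, hz1, he1, hc1⟩ := exists_central_mod hn Z (span ℂ {e2, e3, e4, e5}) hZ (by
      simpa using not_le_span (W := Z) {e2, e3, e4, e5} 4 Finset.card_le_four (by omega))
    have hz4 : e4 ∈ Z := (mZ _).mpr (h.2.2.1 _)
    have hz5 : e5 ∈ Z := (mZ _).mpr (by rw [skew, hc5, neg_zero])
    have he0 : e0 ∉ span ℂ {e1, e2, e3, e4, e5} := by
      intro hmem
      have hle : span ℂ {e1, e2, e3, e4, e5} ≤ Z := by
        rw [Submodule.span_le]
        rintro x (rfl | rfl | rfl | rfl | rfl)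
        exacts [hz1, hz2, hz3, hz4, hz5]
      exact hne ((mZ _).mp (hle hmem))
    obtain ⟨a3, a4, a5, a6, h01⟩ := mem_span_four (hc1 e0)
    obtain ⟨b4, b5, b6, h02⟩ := Submodule.mem_span_triple.mp (hc2 e0)
    obtain ⟨c4, c5, c6, h12⟩ := Submodule.mem_span_triple.mp (hc2 e1)
    obtain ⟨d5, d6, h03⟩ := Submodule.mem_span_pair.mp (hc3 e0)
    obtain ⟨f5, f6, h13⟩ := Submodule.mem_span_pair.mp (hc3 e1)
    obtain ⟨g5, g6, h23⟩ := Submodule.mem_span_pair.mp (hc3 e2)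
    exact frame_mem h e0 e1 e2 e3 e4 e5 (li_six he5 he4 he3 he2 he1 he0)
      a3 a4 a5 a6 b4 b5 b6 c4 c5 c6 d5 d6 f5 f6 g5 g6 p h01 h02.symm h12.symm h03.symm
      h13.symm h23.symm hp ((mZ _).mp hz1) ((mZ _).mp hz2) ((mZ _).mp hz3) hc5 (Or.inl hp0)

/-! ### Closedness of the set of nilpotent laws -/

/-- Iterated left brackets. -/
def nest {n : ℕ} (μ : V n → V n → V n) (l : List (V n)) (y : V n) : V n := l.foldr μ y

theorem lcs_nest {n : ℕ} {μ : V n → V n → V n} (h : IsLieLaw μ) (j : ℕ)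
    (hj : ∀ l : List (V n), l.length = j → ∀ y, nest μ l y = 0) : IsNilpotentLaw μ := by
  have lin : ∀ l : List (V n), ∃ f : V n →ₗ[ℂ] V n, ∀ y, f y = nest μ l y := by
    intro l
    induction l with
    | nil => exact ⟨LinearMap.id, fun y => rfl⟩
    | cons x l ih =>
      obtain ⟨f, hf⟩ := ih
      exact ⟨h.bil x ∘ₗ f, fun y => by simp [hf, h.bil_apply, nest]⟩
  have main : ∀ i k, i + k = j → ∀ y ∈ lcs μ k, ∀ l : List (V n), l.length = i →
      nest μ l y = 0 := by
    intro i k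
    induction k generalizing i with
    | zero =>
      intro hik y _ l hl
      exact hj l (by omega) y
    | succ k ih =>
      intro hik y hy l hl
      obtain ⟨f, hf⟩ := lin l
      have hle : lcs μ (k + 1) ≤ LinearMap.ker f := by
        rw [lcs, Submodule.span_le]
        rintro z ⟨x, w, hw, rfl⟩
        have := ih (i + 1) (by omega) w hw (l ++ [x]) (by simp [hl])
        simp only [SetLike.mem_coe, LinearMap.mem_ker, hf]
        simpa [nest] using this
      rw [← hf]
      exact hle hy
  refine ⟨j, ?_⟩
  rw [eq_bot_iff]
  intro y hy
  have := main 0 j (by omega) y hy [] rfl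
  simpa [nest] using this

theorem g6E_lie : IsLieLaw g6ELaw := by
  refine ⟨?_, ?_, ?_, ?_⟩
  · intro a x y z
    ext i
    fin_cases i <;> simp [g6ELaw] <;> ring
  · intro a x y z
    ext i
    fin_cases i <;> simp [g6ELaw] <;> ring
  · intro x
    ext i
    fin_cases i <;> simp [g6ELaw] <;> ring
  · intro x y z
    ext i
    fin_cases i <;> simp [g6ELaw] <;> ring

theorem g6E_nest (l : List (V 6)) (hl : l.length = 5) (y : V 6) : nest g6ELaw l y = 0 := by
  obtain ⟨x1, x2, x3, x4, x5, rfl⟩ : ∃ x1 x2 x3 x4 x5, l = [x1, x2, x3, x4, x5] := by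
    match l, hl with
    | [x1, x2, x3, x4, x5], _ => exact ⟨x1, x2, x3, x4, x5, rfl⟩
  simp only [nest, List.foldr]
  ext i
  fin_cases i <;> simp [g6ELaw]

theorem nest_act {n : ℕ} (g : V n ≃ₗ[ℂ] V n) (μ : V n → V n → V n) (l : List (V n)) (y : V n) :
    nest (act g μ) l y = g (nest μ (l.map g.symm) (g.symm y)) := by
  induction l with
  | nil => simp [nest]
  | cons x l ih =>
    simp only [nest, List.foldr, List.map] at ih ⊢
    rw [ih]
    simp [act]

theorem act_lie {n : ℕ} (g : V n ≃ₗ[ℂ] V n) {μ : V n → V n → V n} (h : IsLieLaw μ) :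
    IsLieLaw (act g μ) := by
  obtain ⟨h1, h2, h3, h4⟩ := h
  refine ⟨?_, ?_, ?_, ?_⟩
  · intro a x y z
    simp [act, h1]
  · intro a x y z
    simp [act, h2]
  · intro x
    simp [act, h3]
  · intro x y z
    simp only [act, LinearEquiv.symm_apply_apply, ← map_add, h4, map_zero]

theorem tendsto_bracket {n : ℕ} {F : Filter (V n → V n → V n)} {ν : V n → V n → V n}
    (hν : ∀ (a : ℂ) (x y z : V n), ν x (a • y + z) = a • ν x y + ν x z)
    (hF : Tendsto id F (𝓝 ν)) (hL : ∀ᶠ μ in F, IsLieLaw μ) (x : V n)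
    {v : (V n → V n → V n) → V n} {w : V n} (hv : Tendsto v F (𝓝 w)) :
    Tendsto (fun μ => μ x (v μ)) F (𝓝 (ν x w)) := by
  have expand : ∀ μ : V n → V n → V n,
      (∀ (a : ℂ) (x y z : V n), μ x (a • y + z) = a • μ x y + μ x z) →
      ∀ y, μ x y = ∑ i, y i • μ x (Pi.single i 1) := by
    intro μ hμ y
    have h0 : μ x 0 = 0 := by simpa using hμ 1 x 0 0
    let f : V n →ₗ[ℂ] V n :=
      { toFun := μ x
        map_add' := fun y z => by simpa using hμ 1 x y z
        map_smul' := fun a y => by simpa [h0] using hμ a x y 0 }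
    have := LinearMap.pi_apply_eq_sum_univ f y
    simp only [f, LinearMap.coe_mk, AddHom.coe_mk] at this
    rw [this]
    refine Finset.sum_congr rfl fun i _ => ?_
    congr 2
    ext j
    simp [Pi.single_apply, eq_comm]
  rw [expand ν hν w]
  have hpt : ∀ y, Tendsto (fun μ : V n → V n → V n => μ x y) F (𝓝 (ν x y)) := fun y =>
    (tendsto_pi_nhds.mp ((tendsto_pi_nhds.mp hF) x)) y
  have h1 : Tendsto (fun μ : V n → V n → V n => ∑ i, v μ i • μ x (Pi.single i 1)) F
      (𝓝 (∑ i, w i • ν x (Pi.single i 1))) :=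
    tendsto_finsetSum _ fun i _ => ((tendsto_pi_nhds.mp hv) i).smul (hpt _)
  refine h1.congr' ?_
  filter_upwards [hL] with μ hμ
  exact (expand μ hμ.2.1 _).symm

theorem closure_sub {ν : V 6 → V 6 → V 6} (h : ν ∈ KK) : IsLieLaw ν ∧ IsNilpotentLaw ν := by
  have hlim : ∃ F : Filter (V 6 → V 6 → V 6), F.NeBot ∧ Tendsto id F (𝓝 ν) ∧
      ∀ᶠ μ in F, μ ∈ lieOrbit g6ELaw :=
    ⟨𝓝[lieOrbit g6ELaw] ν, mem_closure_iff_nhdsWithin_neBot.mp h,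
      tendsto_id.mono_left nhdsWithin_le_nhds, self_mem_nhdsWithin⟩
  obtain ⟨F, hne, hF, hO⟩ := hlim
  have hL : ∀ᶠ μ in F, IsLieLaw μ := by
    filter_upwards [hO]
    rintro _ ⟨g, rfl⟩
    exact act_lie g g6E_lie
  have hpt : ∀ x y, Tendsto (fun μ : V 6 → V 6 → V 6 => μ x y) F (𝓝 (ν x y)) := fun x y =>
    (tendsto_pi_nhds.mp ((tendsto_pi_nhds.mp hF) x)) y
  have n1 : ∀ (a : ℂ) (x y z : V 6), ν (a • x + y) z = a • ν x z + ν y z := by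
    intro a x y z
    refine tendsto_nhds_unique_of_eventuallyEq (hpt _ _)
      (((hpt x z).const_smul a).add (hpt y z)) ?_
    filter_upwards [hL] with μ hμ using hμ.1 a x y z
  have n2 : ∀ (a : ℂ) (x y z : V 6), ν x (a • y + z) = a • ν x y + ν x z := by
    intro a x y z
    refine tendsto_nhds_unique_of_eventuallyEq (hpt _ _)
      (((hpt x y).const_smul a).add (hpt x z)) ?_
    filter_upwards [hL] with μ hμ using hμ.2.1 a x y z
  have n3 : ∀ x, ν x x = 0 := by
    intro x
    refine tendsto_nhds_unique_of_eventuallyEq (hpt x x) tendsto_const_nhds ?_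
    filter_upwards [hL] with μ hμ using hμ.2.2.1 x
  have n4 : ∀ x y z, ν x (ν y z) + ν y (ν z x) + ν z (ν x y) = 0 := by
    intro x y z
    refine tendsto_nhds_unique_of_eventuallyEq
      (((tendsto_bracket n2 hF hL x (hpt y z)).add (tendsto_bracket n2 hF hL y (hpt z x))).add
        (tendsto_bracket n2 hF hL z (hpt x y))) tendsto_const_nhds ?_
    filter_upwards [hL] with μ hμ using hμ.2.2.2 x y z
  have hlie : IsLieLaw ν := ⟨n1, n2, n3, n4⟩
  refine ⟨hlie, lcs_nest hlie 5 ?_⟩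
  intro l hl y
  have ht : ∀ l : List (V 6), Tendsto (fun μ => nest μ l y) F (𝓝 (nest ν l y)) := by
    intro l
    induction l with
    | nil => exact tendsto_const_nhds
    | cons x l ih => exact tendsto_bracket n2 hF hL x ih
  refine tendsto_nhds_unique_of_eventuallyEq (ht l) tendsto_const_nhds ?_
  filter_upwards [hO]
  rintro _ ⟨g, rfl⟩
  rw [nest_act, g6E_nest _ (by simpa using hl), map_zero]

theorem stmt11 :
    {μ : V 6 → V 6 → V 6 | IsLieLaw μ ∧ IsNilpotentLaw μ} = closure (lieOrbit g6ELaw) := by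
  ext μ
  exact ⟨fun h => nilpotent_mem h.1 h.2, fun h => closure_sub h⟩
end
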